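/- Let R be an associative ring with identity, let (A,B) be a hereditary cotorsion pair in Mod R, and let X be a CE A complex. Then for every module B ∈ B and every s ∈ ℤ the canonical map γ_s : Hom_{D(R)}(X, S(B)⟦s⟧) → Hom_R(H^{-s}(X), B) is bijective. (The inclusion CE-A ⊆ A_P of Lemma 2.4.) -/

import Mathlib

open CategoryTheory Limits DerivedCategory Pretriangulated

noncomputable section

universe w u

variable {R : Type u} [Ring R]

def Ext1Zero [HasExt.{w} (ModuleCat.{u} R)] (A B : ModuleCat.{u} R) : Prop :=
  Subsingleton (Abelian.Ext A B 1)

def IsSES {K M N : ModuleCat.{u} R} (i : K ⟶ M) (p : M ⟶ N) : Prop :=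
  Function.Injective i ∧ Function.Surjective p ∧ Function.Exact i p

def IsCotorsionPair [HasExt.{w} (ModuleCat.{u} R)] (A B : Set (ModuleCat.{u} R)) : Prop :=
  (∀ M : ModuleCat.{u} R, M ∈ A ↔ ∀ N ∈ B, Ext1Zero M N) ∧
  (∀ N : ModuleCat.{u} R, N ∈ B ↔ ∀ M ∈ A, Ext1Zero M N)

def IsCompleteCP (A B : Set (ModuleCat.{u} R)) : Prop :=
  ∀ M : ModuleCat.{u} R,
    (∃ (B' A' : ModuleCat.{u} R) (i : B' ⟶ A') (p : A' ⟶ M),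
      B' ∈ B ∧ A' ∈ A ∧ IsSES i p) ∧
    (∃ (B' A' : ModuleCat.{u} R) (i : M ⟶ B') (p : B' ⟶ A'),
      B' ∈ B ∧ A' ∈ A ∧ IsSES i p)

def IsHereditaryCP (A B : Set (ModuleCat.{u} R)) : Prop :=
  (∀ (K A₁ A₂ : ModuleCat.{u} R) (i : K ⟶ A₁) (p : A₁ ⟶ A₂),
    A₁ ∈ A → A₂ ∈ A → IsSES i p → K ∈ A) ∧
  (∀ (B₁ B₂ K : ModuleCat.{u} R) (i : B₁ ⟶ B₂) (p : B₂ ⟶ K),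
    B₁ ∈ B → B₂ ∈ B → IsSES i p → K ∈ B)

def IsCE (S : Set (ModuleCat.{u} R)) (W : CochainComplex (ModuleCat.{u} R) ℤ) : Prop :=
  ∀ s : ℤ, W.X s ∈ S ∧ W.cycles s ∈ S ∧ image (W.d (s-1) s) ∈ S ∧ W.homology s ∈ S

variable [HasDerivedCategory.{w} (ModuleCat.{u} R)]

def stalk (M : ModuleCat.{u} R) : DerivedCategory (ModuleCat.{u} R) :=
  DerivedCategory.Q.obj
    ((HomologicalComplex.single (ModuleCat.{u} R) (ComplexShape.up ℤ) 0).obj M)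

def stalkHomologyIso (M : ModuleCat.{u} R) :
    (homologyFunctor (ModuleCat.{u} R) 0).obj (stalk M) ≅ M :=
  (homologyFunctorFactors (ModuleCat.{u} R) 0).app _ ≪≫
    (HomologicalComplex.homologyFunctorSingleIso (ModuleCat.{u} R) (ComplexShape.up ℤ) 0).app M

def shiftHomologyIso (X : DerivedCategory (ModuleCat.{u} R)) (s a a' : ℤ) (h : s + a = a') :
    (homologyFunctor (ModuleCat.{u} R) a).obj (X⟦s⟧) ≅
      (homologyFunctor (ModuleCat.{u} R) a').obj X :=
  ((homologyFunctor (ModuleCat.{u} R) 0).shiftIso s a a' h).app X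

def gammaMap (X : DerivedCategory (ModuleCat.{u} R)) (M : ModuleCat.{u} R) (s : ℤ)
    (f : X ⟶ (stalk M)⟦s⟧) : (homologyFunctor (ModuleCat.{u} R) (-s)).obj X ⟶ M :=
  (homologyFunctor (ModuleCat.{u} R) (-s)).map f ≫
    (shiftHomologyIso (stalk M) s (-s) 0 (by ring)).hom ≫ (stalkHomologyIso M).hom

open HomologicalComplex

section Abelian

universe v t

variable {C : Type t} [Category.{v} C] [Abelian C]

lemma CategoryTheory.ShortComplex.ShortExact.exists_lift_of_subsingleton_ext [HasExt.{w} C]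
    {S : ShortComplex C} (hS : S.ShortExact) {M : C} [Subsingleton (Abelian.Ext M S.X₁ 1)]
    (f : M ⟶ S.X₃) : ∃ g : M ⟶ S.X₂, g ≫ S.g = f := by
  obtain ⟨x, hx⟩ := Abelian.Ext.covariant_sequence_exact₃ M hS (Abelian.Ext.mk₀ f)
    (zero_add 1) (Subsingleton.elim _ _)
  obtain ⟨g, rfl⟩ := (Abelian.Ext.mk₀_bijective M S.X₂).2 x
  refine ⟨g, (Abelian.Ext.mk₀_bijective _ _).1 ?_⟩
  rw [← hx, Abelian.Ext.mk₀_comp_mk₀]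

lemma CategoryTheory.ShortComplex.ShortExact.exists_extension_of_subsingleton_ext [HasExt.{w} C]
    {S : ShortComplex C} (hS : S.ShortExact) {N : C} [Subsingleton (Abelian.Ext S.X₃ N 1)]
    (f : S.X₁ ⟶ N) : ∃ g : S.X₂ ⟶ N, S.f ≫ g = f := by
  obtain ⟨x, hx⟩ := Abelian.Ext.contravariant_sequence_exact₁ hS N (Abelian.Ext.mk₀ f)
    (add_zero 1) (Subsingleton.elim _ _)
  obtain ⟨g, rfl⟩ := (Abelian.Ext.mk₀_bijective S.X₂ N).2 x
  refine ⟨g, (Abelian.Ext.mk₀_bijective _ _).1 ?_⟩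
  rw [← hx, Abelian.Ext.mk₀_comp_mk₀]

namespace CochainComplex

variable (K : CochainComplex C ℤ)

lemma exact_iCycles_d (q p : ℤ) (h : q + 1 = p) :
    (ShortComplex.mk (K.iCycles q) (K.d q p) (by simp)).Exact :=
  ShortComplex.exact_of_f_is_kernel _ (K.cyclesIsKernel q p (by simp [← h]))

lemma shortExact_iCycles_factorThruImage (q p : ℤ) (h : q + 1 = p) :
    (ShortComplex.mk (K.iCycles q) (factorThruImage (K.d q p))
      (by rw [← cancel_mono (image.ι _)]; simp)).ShortExact where
  exact := (ShortComplex.exact_iff_of_epi_of_isIso_of_mono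
    (S₁ := ShortComplex.mk (K.iCycles q) (factorThruImage (K.d q p)) _)
    (S₂ := ShortComplex.mk (K.iCycles q) (K.d q p) (by simp))
    { τ₁ := 𝟙 _, τ₂ := 𝟙 _, τ₃ := image.ι _ }).2 (K.exact_iCycles_d q p h)
  mono_f := by dsimp; infer_instance
  epi_g := by dsimp; infer_instance

/-- The inclusion of the boundaries into the cycles. -/
def imageToCycles (q p : ℤ) : image (K.d q p) ⟶ K.cycles p :=
  K.liftCycles (image.ι (K.d q p)) (p + 1) (by simp)
    (by rw [← cancel_epi (factorThruImage (K.d q p))]; simp)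

@[simp]
lemma imageToCycles_iCycles (q p : ℤ) :
    K.imageToCycles q p ≫ K.iCycles p = image.ι (K.d q p) := by
  simp [imageToCycles]

lemma factorThruImage_imageToCycles (q p : ℤ) :
    factorThruImage (K.d q p) ≫ K.imageToCycles q p = K.toCycles q p := by
  simp [← cancel_mono (K.iCycles p)]

instance (q p : ℤ) : Mono (K.imageToCycles q p) :=
  mono_of_mono_fac (K.imageToCycles_iCycles q p)

lemma shortExact_imageToCycles_homologyπ (q p : ℤ) (h : q + 1 = p) :
    (ShortComplex.mk (K.imageToCycles q p) (K.homologyπ p)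
      (by rw [← cancel_epi (factorThruImage (K.d q p)), ← Category.assoc,
            factorThruImage_imageToCycles]; simp)).ShortExact where
  exact := (ShortComplex.exact_iff_of_epi_of_isIso_of_mono
    (S₁ := ShortComplex.mk (K.toCycles q p) (K.homologyπ p) (by simp))
    (S₂ := ShortComplex.mk (K.imageToCycles q p) (K.homologyπ p) _)
    { τ₁ := factorThruImage _, τ₂ := 𝟙 _, τ₃ := 𝟙 _
      comm₁₂ := by simp [factorThruImage_imageToCycles] }).1
    (ShortComplex.exact_of_g_is_cokernel _
      (K.homologyIsCokernel q p (by simp [← h])))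
  mono_f := by dsimp; infer_instance
  epi_g := by dsimp; infer_instance

lemma shortExact_iCycles_toCycles (q p : ℤ) (h : q + 1 = p) (hp : K.ExactAt p) :
    (ShortComplex.mk (K.iCycles q) (K.toCycles q p)
      (by rw [← cancel_mono (K.iCycles p)]; simp)).ShortExact where
  exact := (ShortComplex.exact_iff_of_epi_of_isIso_of_mono
    (S₁ := ShortComplex.mk (K.iCycles q) (K.toCycles q p) _)
    (S₂ := ShortComplex.mk (K.iCycles q) (K.d q p) (by simp))
    { τ₁ := 𝟙 _, τ₂ := 𝟙 _, τ₃ := K.iCycles p }).2 (K.exact_iCycles_d q p h)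
  mono_f := by dsimp; infer_instance
  epi_g := Preadditive.epi_of_isZero_cokernel' _
    (K.homologyIsCokernel q p (by simp [← h])) hp.isZero_homology

variable {K} {L : CochainComplex C ℤ}

lemma exists_homotopy_iCycles_comp_eq_zero (φ : K ⟶ L)
    (hφ : ∀ q p : ℤ, q + 1 = p →
      ∃ g : K.X p ⟶ L.X q, K.iCycles p ≫ g ≫ L.d q p = K.iCycles p ≫ φ.f p) :
    ∃ ψ : K ⟶ L, Nonempty (Homotopy φ ψ) ∧ ∀ p, K.iCycles p ≫ ψ.f p = 0 := by
  choose g hg using hφ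
  let ν : K ⟶ L := Homotopy.nullHomotopicMap' fun i j hij => g j i hij
  refine ⟨φ - ν, ⟨(Homotopy.equivSubZero.symm ((Homotopy.ofEq (by simp [ν])).trans
    (Homotopy.nullHomotopy' fun i j hij => g j i hij)))⟩, fun p => ?_⟩
  have : ν.f p = _ := Homotopy.nullHomotopicMap'_f (c := ComplexShape.up ℤ)
    (k₂ := p - 1) (k₁ := p) (k₀ := p + 1) (by simp) (by simp) _
  simp [this, hg (p - 1) p (by simp)]

lemma nonempty_homotopy_zero_of_forall (φ : K ⟶ L)
    (hφ : ∀ q p r : ℤ, q + 1 = p → p + 1 = r →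
      ∃ (a : K.X p ⟶ L.X q) (b : K.X r ⟶ L.X p), K.d q p ≫ a = 0 ∧ b ≫ L.d p r = 0 ∧
        K.d p r ≫ b + a ≫ L.d q p = φ.f p) :
    Nonempty (Homotopy φ 0) := by
  choose a b ha hb hab using hφ
  let k : ∀ i j : ℤ, (ComplexShape.up ℤ).Rel j i → (K.X i ⟶ L.X j) := fun i j hij =>
    a j i (i + 1) hij rfl + b (j - 1) j i (by simp) hij
  refine ⟨(Homotopy.ofEq ?_).trans (Homotopy.nullHomotopy' k)⟩
  ext p
  have h₁ : (ComplexShape.up ℤ).Rel (p - 1) p := by simp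
  have h₂ : (ComplexShape.up ℤ).Rel p (p + 1) := by simp
  rw [Homotopy.nullHomotopicMap'_f h₁ h₂, ← hab (p - 1) p (p + 1) h₁ h₂]
  simp [k, ha p (p + 1) (p + 1 + 1) h₂ rfl, hb (p - 1 - 1) (p - 1) p (by simp) h₁]

lemma exists_hom_homologyMap_eq [HasExt.{w} C] (m : ℤ)
    (hL : ∀ i < m, IsZero (L.X i))
    (h : Subsingleton (Abelian.Ext (image (K.d m (m + 1))) (L.cycles m) 1))
    (g : K.homology m ⟶ L.homology m) :
    ∃ φ : K ⟶ L, homologyMap φ m = g := by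
  have := L.isIso_homologyπ (m - 1) m (by simp) ((hL _ (by lia)).eq_of_src _ _)
  obtain ⟨ξ, hξ⟩ := (K.shortExact_iCycles_factorThruImage m (m + 1) rfl)
    |>.exists_extension_of_subsingleton_ext (K.homologyπ m ≫ g ≫ inv (L.homologyπ m))
  dsimp at ξ hξ
  let φ : K ⟶ L := mkHomToSingle ξ (fun i _ => by
      rw [← K.toCycles_i, Category.assoc, hξ, toCycles_comp_homologyπ_assoc, zero_comp]) ≫
    mkHomFromSingle (L.iCycles m) (fun i _ => by simp)
  have hφ : φ.f m = ξ ≫ L.iCycles m := by simp [φ]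
  refine ⟨φ, ?_⟩
  rw [← cancel_epi (K.homologyπ m), homologyπ_naturality, ← cancel_mono (inv (L.homologyπ m)),
    ← cancel_mono (L.iCycles m)]
  simp [hφ, reassoc_of% hξ]

lemma nonempty_homotopy_zero_of_homologyMap_eq_zero [HasExt.{w} C] (m : ℤ)
    [∀ i, Injective (L.X i)] (hL : ∀ i < m, IsZero (L.X i)) (hLm : ∀ i > m, L.ExactAt i)
    (hC : ∀ i j, m ≤ j → Subsingleton (Abelian.Ext (K.cycles i) (L.cycles j) 1))
    (hB : ∀ q p j, q + 1 = p → m ≤ j →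
      Subsingleton (Abelian.Ext (image (K.d q p)) (L.cycles j) 1))
    (hH : ∀ i j, m ≤ j → Subsingleton (Abelian.Ext (K.homology i) (L.cycles j) 1))
    (φ : K ⟶ L) (hφ : homologyMap φ m = 0) : Nonempty (Homotopy φ 0) := by
  obtain ⟨ψ, ⟨h⟩, hψ⟩ := exists_homotopy_iCycles_comp_eq_zero φ (fun q p hqp => by
    obtain hp | rfl | hp := lt_trichotomy p m
    · exact ⟨0, (hL p hp).eq_of_tgt _ _⟩
    · refine ⟨0, ?_⟩
      have := L.isIso_homologyπ q p (by simp [← hqp]) ((hL _ (by lia)).eq_of_src _ _)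
      have : cyclesMap φ p = 0 := by
        rw [← cancel_mono (L.homologyπ p), ← homologyπ_naturality, hφ, comp_zero, zero_comp]
      rw [← cyclesMap_i, this]
      simp
    · have := hC p q (by lia)
      obtain ⟨g, hg⟩ := (L.shortExact_iCycles_toCycles q p hqp (hLm p hp))
        |>.exists_lift_of_subsingleton_ext (cyclesMap φ p)
      dsimp at g hg
      refine ⟨Injective.factorThru g (K.iCycles p), ?_⟩
      rw [Injective.comp_factorThru_assoc, ← L.toCycles_i, reassoc_of% hg, cyclesMap_i])
  obtain ⟨h'⟩ := nonempty_homotopy_zero_of_forall ψ (fun q p r hqp hpr => by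
    obtain hp | hp := lt_or_ge p m
    · exact ⟨0, 0, by simp, by simp, (hL p hp).eq_of_tgt _ _⟩
    have hu : ψ.f p ≫ L.d p r = 0 := by
      rw [ψ.comm, ← K.toCycles_i, Category.assoc, hψ, comp_zero]
    have hS := K.shortExact_iCycles_factorThruImage p r hpr
    obtain ⟨h, hh⟩ : ∃ h : image (K.d p r) ⟶ L.cycles p, factorThruImage (K.d p r) ≫ h =
        L.liftCycles (ψ.f p) r (by simp [← hpr]) hu :=
      ⟨hS.exact.desc (L.liftCycles (ψ.f p) r (by simp [← hpr]) hu)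
        (by simp [← cancel_mono (L.iCycles p), hψ]), hS.exact.g_desc _ _⟩
    obtain rfl | hp := hp.eq_or_lt
    · have := hH r m le_rfl
      obtain ⟨h₁, hh₁⟩ := (K.shortExact_imageToCycles_homologyπ m r hpr)
        |>.exists_extension_of_subsingleton_ext h
      have := hB r (r + 1) m rfl le_rfl
      obtain ⟨h₂, hh₂⟩ := (K.shortExact_iCycles_factorThruImage r (r + 1) rfl)
        |>.exists_extension_of_subsingleton_ext h₁
      dsimp at h₁ hh₁ h₂ hh₂
      refine ⟨0, h₂ ≫ L.iCycles m, by simp, by simp, ?_⟩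
      rw [zero_comp, add_zero, ← K.toCycles_i, ← factorThruImage_imageToCycles]
      simp only [Category.assoc, reassoc_of% hh₂, reassoc_of% hh₁, reassoc_of% hh, liftCycles_i]
    · have := hB p r q hpr (by lia)
      obtain ⟨h', hh'⟩ := (L.shortExact_iCycles_toCycles q p hqp (hLm p hp))
        |>.exists_lift_of_subsingleton_ext h
      dsimp at h' hh'
      refine ⟨factorThruImage (K.d p r) ≫ h', 0, ?_, by simp, ?_⟩
      · have : K.d q p ≫ factorThruImage (K.d p r) = 0 := by
          rw [← cancel_mono (image.ι _)]; simp
        rw [reassoc_of% this, zero_comp]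
      · rw [comp_zero, zero_add, Category.assoc, ← L.toCycles_i, reassoc_of% hh',
          reassoc_of% hh, liftCycles_i])
  exact ⟨h.trans h'⟩

end CochainComplex

end Abelian

section DerivedCategory

universe v t

variable {C : Type t} [Category.{v} C] [Abelian C] [HasDerivedCategory.{w} C]

lemma DerivedCategory.Q_map_surjective_of_isKInjective (K L : CochainComplex C ℤ)
    [L.IsKInjective] : Function.Surjective (Q.map : (K ⟶ L) → (Q.obj K ⟶ Q.obj L)) := by
  intro f
  obtain ⟨g, hg⟩ := (CochainComplex.IsKInjective.Qh_map_bijective _ L).2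
    ((quotientCompQhIso C).hom.app K ≫ f ≫ (quotientCompQhIso C).inv.app L)
  obtain ⟨φ, rfl⟩ := (HomotopyCategory.quotient _ _).map_surjective g
  refine ⟨φ, ?_⟩
  rw [← cancel_epi ((quotientCompQhIso C).hom.app K), ← quotientCompQhIso_hom_naturality, hg]
  simp

lemma DerivedCategory.Q_map_eq_zero_of_homotopy {K L : CochainComplex C ℤ} {φ : K ⟶ L}
    (h : Homotopy φ 0) : Q.map φ = 0 := by
  rw [← cancel_epi ((quotientCompQhIso C).hom.app K), ← quotientCompQhIso_hom_naturality,
    HomotopyCategory.eq_of_homotopy _ _ h]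
  simp

/-- The homology of the image of a cochain complex in the derived category. -/
def DerivedCategory.homologyObjQIso (K : CochainComplex C ℤ) (n : ℤ) :
    (homologyFunctor C n).obj (Q.obj K) ≅ K.homology n :=
  (homologyFunctorFactors C n).app K

lemma DerivedCategory.homologyFunctor_map_Q_map {K L : CochainComplex C ℤ}
    (φ : K ⟶ L) (n : ℤ) :
    (homologyFunctor C n).map (Q.map φ) =
      (homologyObjQIso K n).hom ≫ homologyMap φ n ≫ (homologyObjQIso L n).inv := by
  rw [← Category.assoc, Iso.eq_comp_inv]
  exact homologyFunctorFactors_hom_naturality φ n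

lemma DerivedCategory.bijective_homologyFunctor_map (K L : CochainComplex C ℤ)
    [L.IsKInjective] (n : ℤ)
    (h₁ : ∀ g : K.homology n ⟶ L.homology n, ∃ φ : K ⟶ L, homologyMap φ n = g)
    (h₂ : ∀ φ : K ⟶ L, homologyMap φ n = 0 → Nonempty (Homotopy φ 0)) :
    Function.Bijective
      (fun f : Q.obj K ⟶ Q.obj L => (homologyFunctor C n).map f) := by
  constructor
  · intro f g hfg
    obtain ⟨φ, hφ⟩ := Q_map_surjective_of_isKInjective K L (f - g)
    have hmap : (homologyFunctor C n).map (Q.map φ) = 0 := by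
      rw [hφ, Functor.map_sub]
      simpa [sub_eq_zero] using hfg
    obtain ⟨h⟩ := h₂ φ (by simpa [homologyFunctor_map_Q_map] using hmap)
    rw [← sub_eq_zero, ← hφ, Q_map_eq_zero_of_homotopy h]
  · intro g
    obtain ⟨φ, hφ⟩ := h₁ ((homologyObjQIso K n).inv ≫ g ≫ (homologyObjQIso L n).hom)
    exact ⟨Q.map φ, by simp [homologyFunctor_map_Q_map, hφ]⟩

end DerivedCategory

section CotorsionPair

variable {S : Type u} [Ring S]

lemma isSES_of_shortExact {T : ShortComplex (ModuleCat.{u} S)} (hT : T.ShortExact) :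
    IsSES T.f T.g :=
  ⟨(ModuleCat.mono_iff_injective _).1 hT.mono_f, (ModuleCat.epi_iff_surjective _).1 hT.epi_g,
    (ShortComplex.ShortExact.moduleCat_exact_iff_function_exact T).1 hT.exact⟩

variable {A B : Set (ModuleCat.{u} S)}

lemma IsHereditaryCP.mem_right_of_shortExact (h : IsHereditaryCP A B)
    {T : ShortComplex (ModuleCat.{u} S)} (hT : T.ShortExact) (h₁ : T.X₁ ∈ B) (h₂ : T.X₂ ∈ B) :
    T.X₃ ∈ B :=
  h.2 _ _ _ T.f T.g h₁ h₂ (isSES_of_shortExact hT)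

lemma IsCE.image_d_mem {W : CochainComplex (ModuleCat.{u} S) ℤ} (hW : IsCE A W)
    (q p : ℤ) (h : q + 1 = p) : image (W.d q p) ∈ A := by
  obtain rfl : q = p - 1 := by lia
  exact (hW p).2.2.1

variable [HasExt.{w} (ModuleCat.{u} S)]

lemma IsCotorsionPair.mem_right_of_injective (h : IsCotorsionPair A B)
    (I : ModuleCat.{u} S) [Injective I] : I ∈ B :=
  (h.2 I).2 fun M _ => Abelian.Ext.subsingleton_of_injective M I 0

lemma IsCotorsionPair.mem_right_of_iso (h : IsCotorsionPair A B) {N N' : ModuleCat.{u} S}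
    (e : N ≅ N') (hN : N ∈ B) : N' ∈ B := by
  refine (h.2 N').2 fun M hM => ?_
  have : Subsingleton (Abelian.Ext M N 1) := (h.2 N).1 hN M hM
  refine subsingleton_of_forall_eq 0 fun x => ?_
  have hx : x.comp (Abelian.Ext.mk₀ e.inv) (add_zero 1) = 0 := Subsingleton.elim _ _
  have := congr_arg (fun y => y.comp (Abelian.Ext.mk₀ e.hom) (add_zero 1)) hx
  simpa using this

lemma IsHereditaryCP.cycles_mem_right (hcp : IsCotorsionPair A B) (h : IsHereditaryCP A B)
    (J : CochainComplex (ModuleCat.{u} S) ℤ) [∀ i, Injective (J.X i)] (m : ℤ)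
    (hJ : ∀ i > m, J.ExactAt i) (hm : J.cycles m ∈ B) (i : ℤ) (hi : m ≤ i) :
    J.cycles i ∈ B := by
  induction i, hi using Int.leInduction with
  | base => exact hm
  | succ i hi ih =>
    exact h.mem_right_of_shortExact
      (J.shortExact_iCycles_toCycles i (i + 1) rfl (hJ _ (by lia))) ih
      (hcp.mem_right_of_injective _)

end CotorsionPair

theorem stmt10 [HasExt.{w} (ModuleCat.{u} R)]
    (A B : Set (ModuleCat.{u} R))
    (hcp : IsCotorsionPair A B) (hhered : IsHereditaryCP A B)
    (X : CochainComplex (ModuleCat.{u} R) ℤ) (hX : IsCE A X) :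
    ∀ N ∈ B, ∀ s : ℤ,
      Function.Bijective (gammaMap (DerivedCategory.Q.obj X) N s) := by
  intro N hN s
  let I := injectiveResolution N
  let J : CochainComplex (ModuleCat.{u} R) ℤ := I.cochainComplex⟦s⟧
  have hι : IsIso (Q.map I.ι') := (isIso_Q_map_iff_quasiIso _ _).2 inferInstance
  let ι : stalk N ≅ Q.obj I.cochainComplex := @asIso _ _ _ _ (Q.map I.ι') hι
  let e : (stalk N)⟦s⟧ ≅ Q.obj J :=
    (shiftFunctor _ s).mapIso ι ≪≫ (Q.commShiftIso s).symm.app _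
  let θ : (homologyFunctor (ModuleCat.{u} R) (-s)).obj ((stalk N)⟦s⟧) ≅ N :=
    shiftHomologyIso (stalk N) s (-s) 0 (by ring) ≪≫ stalkHomologyIso N
  have : ∀ i, Injective (J.X i) := fun i =>
    inferInstanceAs (Injective (I.cochainComplex.X (i + s)))
  have : J.IsStrictlyGE (-s) := I.cochainComplex.isStrictlyGE_shift 0 s (-s) (by ring)
  have : J.IsLE (-s) := I.cochainComplex.isLE_shift 0 s (-s) (by ring)
  have hJ : ∀ i < -s, IsZero (J.X i) := fun i hi => J.isZero_of_isStrictlyGE (-s) i hi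
  have hJ' : ∀ i > -s, J.ExactAt i := fun i hi => J.exactAt_of_isLE (-s) i hi
  have hcycles : J.cycles (-s) ∈ B := by
    have := J.isIso_homologyπ (-s - 1) (-s) (by simp) ((hJ _ (by lia)).eq_of_src _ _)
    exact hcp.mem_right_of_iso (θ.symm ≪≫ (homologyFunctor _ (-s)).mapIso e ≪≫
      homologyObjQIso J (-s) ≪≫ (asIso (J.homologyπ (-s))).symm) hN
  have hext : ∀ M ∈ A, ∀ j, -s ≤ j → Subsingleton (Abelian.Ext M (J.cycles j) 1) :=
    fun M hM j hj => (hcp.1 M).1 hM _ (hhered.cycles_mem_right hcp J (-s) hJ' hcycles j hj)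
  have : J.IsKInjective := CochainComplex.isKInjective_of_injective J (-s)
  have key := bijective_homologyFunctor_map X J (-s)
    (CochainComplex.exists_hom_homologyMap_eq (-s) hJ
      (hext _ (hX.image_d_mem _ _ rfl) _ le_rfl))
    (CochainComplex.nonempty_homotopy_zero_of_homologyMap_eq_zero (-s) hJ hJ'
      (fun i => hext _ (hX i).2.1)
      (fun q p j h => hext _ (hX.image_d_mem q p h) j)
      (fun i => hext _ (hX i).2.2.2))
  have hγ : gammaMap (Q.obj X) N s =
      (((homologyFunctor _ (-s)).mapIso e.symm ≪≫ θ).homToEquiv (X := _)) ∘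
        (fun f : Q.obj X ⟶ Q.obj J => (homologyFunctor _ (-s)).map f) ∘ e.homToEquiv := by
    ext1 f
    simp [gammaMap, θ]
  rw [hγ]
  exact (Equiv.bijective _).comp (key.comp (Equiv.bijective _))
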